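/- Let f : ℕ₀ → [0,∞) and set S(k) = Σ_{y≥k} f(y). Suppose there exist c′ > 0 and ν ∈ (0,1) such that S(k) = c′·k^{−ν} + o(k^{−ν}) as k → ∞. Then there exists t₀ > 0 such that Σ_{k≥0} f(k)·sin(tk) > 0 for all t ∈ (0, t₀]. -/

import Mathlib

open Asymptotics Filter

theorem continuousOn_rpow_neg_mul_sin {ν : ℝ} (hν1 : ν < 1) :
    ContinuousOn (fun u : ℝ => u ^ (-ν) * Real.sin u) (Set.Ici 0) := by
  intro u hu
  rcases eq_or_lt_of_le (Set.mem_Ici.mp hu) with rfl | hu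
  · have hlim : Tendsto (fun u : ℝ => u ^ (1 - ν)) (nhdsWithin 0 (Set.Ici 0)) (nhds 0) := by
      have h := (Real.continuousAt_rpow_const 0 (1 - ν) (Or.inr (by linarith))).tendsto
      rw [Real.zero_rpow (by linarith)] at h
      exact h.mono_left nhdsWithin_le_nhds
    have hz : (0 : ℝ) ^ (-ν) * Real.sin 0 = 0 := by simp
    rw [ContinuousWithinAt, hz]
    refine squeeze_zero_norm' ?_ hlim
    filter_upwards [self_mem_nhdsWithin] with x hx
    rcases eq_or_lt_of_le (Set.mem_Ici.mp hx) with rfl | hx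
    · rw [hz, norm_zero]
      exact Real.rpow_nonneg le_rfl _
    · rw [norm_mul, Real.norm_of_nonneg (Real.rpow_nonneg hx.le _), sub_eq_add_neg, add_comm,
        Real.rpow_add hx, Real.rpow_one]
      refine mul_le_mul_of_nonneg_left ?_ (Real.rpow_nonneg hx.le _)
      simpa [abs_of_pos hx] using Real.abs_sin_le_abs (x := x)
  · exact ((Real.continuousAt_rpow_const u _ (Or.inl hu.ne')).mul
      Real.continuous_sin.continuousAt).continuousWithinAt

theorem intervalIntegrable_rpow_neg_mul_cos {ν : ℝ} (hν1 : ν < 1) (a b : ℝ) :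
    IntervalIntegrable (fun u : ℝ => u ^ (-ν) * Real.cos u) MeasureTheory.volume a b :=
  (intervalIntegral.intervalIntegrable_rpow' (by linarith)).mul_continuousOn
    Real.continuous_cos.continuousOn

/-- A lower bound for `∫ u in a..b, u ^ (-ν) * cos u`, from integration by parts when
`(u ^ (-ν - 1) - d) * sin u` is nonnegative on `(a, b)`. -/
theorem sub_le_integral_rpow_neg_mul_cos {ν : ℝ} (hν0 : 0 < ν) (hν1 : ν < 1) {a b : ℝ}
    (ha : 0 ≤ a) (hab : a ≤ b) (d : ℝ)
    (hd : ∀ u ∈ Set.Ioo a b, 0 ≤ (u ^ (-ν - 1) - d) * Real.sin u) :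
    (b ^ (-ν) * Real.sin b - ν * d * Real.cos b) - (a ^ (-ν) * Real.sin a - ν * d * Real.cos a)
      ≤ ∫ u in a..b, u ^ (-ν) * Real.cos u := by
  refine intervalIntegral.sub_le_integral_of_hasDeriv_right_of_le
    (g := fun u : ℝ => u ^ (-ν) * Real.sin u - ν * d * Real.cos u)
    (g' := fun u : ℝ => (-ν * u ^ (-ν - 1) * Real.sin u + u ^ (-ν) * Real.cos u)
      - ν * d * (-Real.sin u)) hab ?_ ?_ ?_ ?_
  · exact ((continuousOn_rpow_neg_mul_sin hν1).mono fun x hx => ha.trans hx.1).sub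
      (by fun_prop)
  · intro x hx
    have hx0 : 0 < x := ha.trans_lt hx.1
    exact (((Real.hasDerivAt_rpow_const (Or.inl hx0.ne')).mul (Real.hasDerivAt_sin x)).sub
      ((Real.hasDerivAt_cos x).const_mul _)).hasDerivWithinAt
  · exact (intervalIntegrable_iff_integrableOn_Icc_of_le hab).1
      (intervalIntegrable_rpow_neg_mul_cos hν1 a b)
  · intro x hx
    nlinarith [mul_nonneg hν0.le (hd x hx)]

theorem integral_rpow_neg_mul_cos_period_nonneg {ν : ℝ} (hν0 : 0 < ν) (hν1 : ν < 1) (j : ℕ) :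
    0 ≤ ∫ u in (j * (2 * Real.pi))..((j + 1 : ℕ) * (2 * Real.pi)), u ^ (-ν) * Real.cos u := by
  have hpi := Real.pi_pos
  have ha : 0 ≤ j * (2 * Real.pi) := by positivity
  have hab : j * (2 * Real.pi) ≤ (j + 1 : ℕ) * (2 * Real.pi) := by
    gcongr; simp
  have h := sub_le_integral_rpow_neg_mul_cos hν0 hν1 ha hab
    ((j * (2 * Real.pi) + Real.pi) ^ (-ν - 1)) ?_
  · rw [Real.cos_nat_mul_two_pi, Real.cos_nat_mul_two_pi] at h
    have hs : ∀ n : ℕ, Real.sin (n * (2 * Real.pi)) = 0 := fun n => by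
      simpa using Real.sin_add_nat_mul_two_pi 0 n
    rw [hs, hs] at h
    simpa using h
  · rintro u ⟨hu1, hu2⟩
    push_cast at hu2
    have hs := Real.sin_sub_nat_mul_two_pi u j
    rcases le_total u (j * (2 * Real.pi) + Real.pi) with h | h
    · refine mul_nonneg (sub_nonneg.2 (Real.rpow_le_rpow_of_nonpos (ha.trans_lt hu1) h
        (by linarith))) ?_
      rw [← hs]
      exact Real.sin_nonneg_of_nonneg_of_le_pi (by linarith) (by linarith)
    · refine mul_nonneg_of_nonpos_of_nonpos (sub_nonpos.2 (Real.rpow_le_rpow_of_nonpos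
        (by linarith) h (by linarith))) ?_
      have := Real.sin_nonneg_of_nonneg_of_le_pi (x := u - j * (2 * Real.pi) - Real.pi)
        (by linarith) (by linarith)
      rw [Real.sin_sub_pi, hs] at this
      linarith

theorem integral_rpow_neg_mul_cos_two_pi_pos {ν : ℝ} (hν0 : 0 < ν) (hν1 : ν < 1) :
    0 < ∫ u in (0 : ℝ)..(2 * Real.pi), u ^ (-ν) * Real.cos u := by
  have hpi := Real.pi_pos
  rw [← intervalIntegral.integral_add_adjacent_intervals
    (intervalIntegrable_rpow_neg_mul_cos hν1 0 (Real.pi / 2))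
    (intervalIntegrable_rpow_neg_mul_cos hν1 (Real.pi / 2) (2 * Real.pi))]
  have h1 := sub_le_integral_rpow_neg_mul_cos hν0 hν1 le_rfl (b := Real.pi / 2) (by linarith)
    ((Real.pi / 2) ^ (-ν - 1)) fun u hu =>
      mul_nonneg (sub_nonneg.2 (Real.rpow_le_rpow_of_nonpos hu.1 hu.2.le (by linarith)))
        (Real.sin_nonneg_of_nonneg_of_le_pi hu.1.le (by linarith [hu.2]))
  have h2 := sub_le_integral_rpow_neg_mul_cos hν0 hν1 (a := Real.pi / 2) (b := 2 * Real.pi)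
    (by linarith) (by linarith) (Real.pi ^ (-ν - 1)) fun u hu => by
      rcases le_total u Real.pi with h | h
      · exact mul_nonneg (sub_nonneg.2 (Real.rpow_le_rpow_of_nonpos (by linarith [hu.1]) h
          (by linarith))) (Real.sin_nonneg_of_nonneg_of_le_pi (by linarith [hu.1]) h)
      · refine mul_nonneg_of_nonpos_of_nonpos (sub_nonpos.2 (Real.rpow_le_rpow_of_nonpos
          hpi h (by linarith))) ?_
        have := Real.sin_nonneg_of_nonneg_of_le_pi (x := u - Real.pi)
          (by linarith) (by linarith [hu.2])
        rw [Real.sin_sub_pi] at this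
        linarith
  have h3 : Real.pi ^ (-ν - 1) < (Real.pi / 2) ^ (-ν - 1) :=
    Real.rpow_lt_rpow_of_neg (by positivity) (by linarith) (by linarith)
  simp only [Real.sin_pi_div_two, Real.cos_pi_div_two, Real.sin_zero, Real.cos_zero,
    Real.sin_two_pi, Real.cos_two_pi] at h1 h2
  nlinarith [mul_pos hν0 (sub_pos.2 h3)]

theorem integral_rpow_neg_mul_cos_two_pi_le {ν : ℝ} (hν0 : 0 < ν) (hν1 : ν < 1) (m : ℕ) :
    ∫ u in (0 : ℝ)..(2 * Real.pi), u ^ (-ν) * Real.cos u ≤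
      ∫ u in (0 : ℝ)..((m + 1 : ℕ) * (2 * Real.pi)), u ^ (-ν) * Real.cos u := by
  induction m with
  | zero => simp
  | succ m ih =>
    rw [← intervalIntegral.integral_add_adjacent_intervals
      (intervalIntegrable_rpow_neg_mul_cos hν1 0 ((m + 1 : ℕ) * (2 * Real.pi)))
      (intervalIntegrable_rpow_neg_mul_cos hν1 _ ((m + 1 + 1 : ℕ) * (2 * Real.pi)))]
    linarith [integral_rpow_neg_mul_cos_period_nonneg hν0 hν1 (m + 1)]

theorem summable_of_tail_asymp {f S : ℕ → ℝ}
    (hS : ∀ k, S k = ∑' y : ℕ, if k ≤ y then f y else 0) {c' : ℝ} (hc' : 0 < c') {ν : ℝ}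
    (hasymp : (fun k : ℕ => S k - c' * (k : ℝ) ^ (-ν)) =o[atTop] fun k : ℕ => (k : ℝ) ^ (-ν)) :
    Summable f := by
  by_contra hf
  have hS0 : ∀ k, S k = 0 := fun k => by
    rw [hS]
    refine tsum_eq_zero_of_not_summable fun h => hf ?_
    rw [← summable_nat_add_iff k] at h ⊢
    simpa using h
  obtain ⟨k, hk, hk0⟩ := ((hasymp.def (half_pos hc')).and (eventually_gt_atTop 0)).exists
  have hpos : 0 < (k : ℝ) ^ (-ν) := Real.rpow_pos_of_pos (by exact_mod_cast hk0) _
  rw [hS0, zero_sub, norm_neg, Real.norm_of_nonneg (by positivity),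
    Real.norm_of_nonneg hpos.le] at hk
  nlinarith [mul_pos hc' hpos]

theorem tail_eq_tsum_sub {f S : ℕ → ℝ}
    (hS : ∀ k, S k = ∑' y : ℕ, if k ≤ y then f y else 0) (hf : Summable f) (n : ℕ) :
    S (n + 1) = ∑' k, f k - ∑ k ∈ Finset.Icc 0 n, f k := by
  have hsum : Summable fun y : ℕ => if n + 1 ≤ y then f y else 0 := by
    rw [← summable_nat_add_iff (n + 1)] at hf ⊢
    simpa using hf
  rw [hS, eq_sub_iff_add_eq', ← Nat.range_succ_eq_Icc_zero, ← hf.sum_add_tsum_nat_add (n + 1),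
    ← hsum.sum_add_tsum_nat_add (n + 1)]
  rw [Finset.sum_eq_zero (s := Finset.range (n + 1)) (f := fun y => if n + 1 ≤ y then f y else 0)]
  · simp
  · intro x hx
    rw [Finset.mem_range] at hx
    exact if_neg (by omega)

theorem tendsto_tail_floor_mul_rpow {S : ℕ → ℝ} {c' ν : ℝ}
    (hasymp : (fun k : ℕ => S k - c' * (k : ℝ) ^ (-ν)) =o[atTop] fun k : ℕ => (k : ℝ) ^ (-ν)) :
    Tendsto (fun x : ℝ => S (⌊x⌋₊ + 1) * x ^ ν) atTop (nhds c') := by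
  have h1 : Tendsto (fun k : ℕ => S k * (k : ℝ) ^ ν) atTop (nhds c') := by
    have h := (hasymp.tendsto_div_nhds_zero).add_const c'
    rw [zero_add] at h
    refine h.congr' ?_
    filter_upwards [eventually_gt_atTop 0] with k hk
    have hk' : (0 : ℝ) < k := by exact_mod_cast hk
    rw [Real.rpow_neg hk'.le]
    have := (Real.rpow_pos_of_pos hk' ν).ne'
    field_simp
    ring
  have h2 : Tendsto (fun x : ℝ => ⌊x⌋₊ + 1) atTop atTop :=
    (tendsto_add_atTop_nat 1).comp tendsto_nat_floor_atTop
  have h3 : Tendsto (fun x : ℝ => (((⌊x⌋₊ + 1 : ℕ) : ℝ) / x) ^ (-ν)) atTop (nhds 1) := by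
    have h := (tendsto_nat_floor_div_atTop (R := ℝ)).add tendsto_inv_atTop_zero
    rw [add_zero] at h
    have h' : Tendsto (fun x : ℝ => ((⌊x⌋₊ + 1 : ℕ) : ℝ) / x) atTop (nhds 1) :=
      h.congr fun x => by push_cast; rw [add_div, one_div]
    simpa using h'.rpow_const (p := -ν) (Or.inl one_ne_zero)
  have h4 := (h1.comp h2).mul h3
  rw [mul_one] at h4
  refine h4.congr' ?_
  filter_upwards [eventually_gt_atTop 0] with x hx
  have hn : (0 : ℝ) < ((⌊x⌋₊ + 1 : ℕ) : ℝ) := by positivity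
  simp only [Function.comp]
  rw [Real.div_rpow hn.le hx.le, Real.rpow_neg hn.le, Real.rpow_neg hx.le]
  have := (Real.rpow_pos_of_pos hn ν).ne'
  have := (Real.rpow_pos_of_pos hx ν).ne'
  field_simp

/-- The error in `T x ~ c' x ^ (-ν)` is bounded for every `x > 0` by an arbitrarily small multiple
of `x ^ (-ν)` and a multiple of the faster decaying `x ^ (-ρ)`. -/
theorem exists_abs_sub_le_rpow_add_rpow {T : ℝ → ℝ} {M c' ν ρ : ℝ} (hT : ∀ x, |T x| ≤ M)
    (hc' : 0 < c') (hν0 : 0 < ν) (hνρ : ν < ρ)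
    (hlim : Tendsto (fun x : ℝ => T x * x ^ ν) atTop (nhds c')) {ε : ℝ} (hε : 0 < ε) :
    ∃ C, 0 ≤ C ∧ ∀ x, 0 < x → |T x - c' * x ^ (-ν)| ≤ ε * x ^ (-ν) + C * x ^ (-ρ) := by
  have hM : 0 ≤ M := (abs_nonneg _).trans (hT 0)
  obtain ⟨N, hN⟩ := eventually_atTop.1 (Metric.tendsto_nhds.1 hlim ε hε)
  set L := max N 1
  have hL0 : 0 < L := lt_of_lt_of_le one_pos (le_max_right _ _)
  refine ⟨M * L ^ ρ + c' * L ^ (ρ - ν), by positivity, fun x hx => ?_⟩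
  have hxν := Real.rpow_pos_of_pos hx (-ν)
  have hxρ := Real.rpow_pos_of_pos hx (-ρ)
  rcases le_total L x with h | h
  · have h1 := hN x ((le_max_left _ _).trans h)
    rw [Real.dist_eq] at h1
    have h2 : T x - c' * x ^ (-ν) = (T x * x ^ ν - c') * x ^ (-ν) := by
      rw [sub_mul, mul_assoc, ← Real.rpow_add hx, add_neg_cancel, Real.rpow_zero, mul_one]
    rw [h2, abs_mul, abs_of_pos hxν]
    have h3 : 0 ≤ (M * L ^ ρ + c' * L ^ (ρ - ν)) * x ^ (-ρ) := by positivity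
    nlinarith
  · have h1 : 1 ≤ L ^ ρ * x ^ (-ρ) := by
      rw [Real.rpow_neg hx.le, ← div_eq_mul_inv, one_le_div (Real.rpow_pos_of_pos hx ρ)]
      exact Real.rpow_le_rpow hx.le h (hν0.trans hνρ).le
    have h2 : x ^ (-ν) ≤ L ^ (ρ - ν) * x ^ (-ρ) := by
      rw [show -ν = (ρ - ν) + -ρ by ring, Real.rpow_add hx]
      gcongr
    have h3 : |T x - c' * x ^ (-ν)| ≤ M + c' * x ^ (-ν) := by
      refine (abs_sub _ _).trans (add_le_add (hT x) (le_of_eq (abs_of_pos (by positivity))))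
    nlinarith [mul_le_mul_of_nonneg_left h1 hM, mul_le_mul_of_nonneg_left h2 hc'.le,
      mul_pos hε hxν]

theorem sum_mul_sin_eq_integral {f : ℕ → ℝ} {T : ℝ → ℝ} {A : ℝ}
    (hT : ∀ x : ℝ, T x = A - ∑ k ∈ Finset.Icc 0 ⌊x⌋₊, f k) {t b : ℝ} (hb : 0 ≤ b)
    (hTi : IntervalIntegrable T MeasureTheory.volume 0 b) (hsin : Real.sin (t * b) = 0) :
    ∑ k ∈ Finset.Icc 0 ⌊b⌋₊, f k * Real.sin (t * k) = ∫ x in 0..b, t * Real.cos (t * x) * T x := by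
  have hd : ∀ x, HasDerivAt (fun x : ℝ => Real.sin (t * x)) (t * Real.cos (t * x)) x := fun x => by
    simpa [mul_comm] using ((hasDerivAt_id x).const_mul t).sin
  have hderiv : deriv (fun x : ℝ => Real.sin (t * x)) = fun x => t * Real.cos (t * x) :=
    funext fun x => (hd x).deriv
  have hcont : Continuous fun x => t * Real.cos (t * x) := by fun_prop
  have h := sum_mul_eq_sub_integral_mul (f := fun x : ℝ => Real.sin (t * x)) f hb
    (fun x _ => (hd x).differentiableAt) (by rw [hderiv]; exact hcont.integrableOn_Icc)
  have h0 : ∫ x in 0..b, t * Real.cos (t * x) = 0 := by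
    rw [intervalIntegral.integral_eq_sub_of_hasDerivAt (fun x _ => hd x)
      (hcont.intervalIntegrable _ _)]
    simp [hsin]
  rw [hsin, hderiv, zero_mul, zero_sub, ← intervalIntegral.integral_of_le hb] at h
  simp_rw [mul_comm (f _), h]
  have h1 : ∀ x : ℝ, t * Real.cos (t * x) * ∑ k ∈ Finset.Icc 0 ⌊x⌋₊, f k =
      t * Real.cos (t * x) * A - t * Real.cos (t * x) * T x := fun x => by rw [hT]; ring
  simp_rw [h1]
  have hcontA : Continuous fun x => t * Real.cos (t * x) * A := by fun_prop
  rw [intervalIntegral.integral_sub (hcontA.intervalIntegrable _ _)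
    (hTi.continuousOn_mul hcont.continuousOn), intervalIntegral.integral_mul_const, h0]
  ring

theorem le_integral_mul_cos_mul {T : ℝ → ℝ} {c' ν ρ ε C R t : ℝ} (hν1 : ν < 1) (hρ1 : ρ < 1)
    (ht : 0 < t) (hR : 0 < R)
    (hTi : IntervalIntegrable T MeasureTheory.volume 0 (R / t))
    (hT : ∀ x, 0 < x → |T x - c' * x ^ (-ν)| ≤ ε * x ^ (-ν) + C * x ^ (-ρ)) :
    c' * t ^ ν * (∫ u in 0..R, u ^ (-ν) * Real.cos u) - ε * t ^ ν * (∫ u in 0..R, u ^ (-ν))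
      - C * t ^ ρ * (∫ u in 0..R, u ^ (-ρ)) ≤ ∫ x in 0..(R / t), t * Real.cos (t * x) * T x := by
  have hi1 := (intervalIntegrable_rpow_neg_mul_cos hν1 0 R).const_mul (c' * t ^ ν)
  have hi2 := (intervalIntegral.intervalIntegrable_rpow' (a := 0) (b := R)
    (show -1 < -ν by linarith)).const_mul (ε * t ^ ν)
  have hi3 := (intervalIntegral.intervalIntegrable_rpow' (a := 0) (b := R)
    (show -1 < -ρ by linarith)).const_mul (C * t ^ ρ)
  set P : ℝ → ℝ := fun u => c' * t ^ ν * (u ^ (-ν) * Real.cos u) - ε * t ^ ν * u ^ (-ν)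
    - C * t ^ ρ * u ^ (-ρ) with hP
  have hPi : IntervalIntegrable P MeasureTheory.volume 0 R := (hi1.sub hi2).sub hi3
  have hcont : Continuous fun x => t * Real.cos (t * x) := by fun_prop
  have hPint : ∫ u in 0..R, P u = c' * t ^ ν * (∫ u in 0..R, u ^ (-ν) * Real.cos u)
      - ε * t ^ ν * (∫ u in 0..R, u ^ (-ν)) - C * t ^ ρ * (∫ u in 0..R, u ^ (-ρ)) := by
    rw [hP, intervalIntegral.integral_sub (hi1.sub hi2) hi3, intervalIntegral.integral_sub hi1 hi2]
    simp only [intervalIntegral.integral_const_mul]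
  have hscale := intervalIntegral.smul_integral_comp_mul_left (f := P) (a := 0) (b := R / t) t
  rw [mul_zero, mul_div_cancel₀ _ ht.ne', smul_eq_mul,
    ← intervalIntegral.integral_const_mul] at hscale
  rw [← hPint, ← hscale]
  refine intervalIntegral.integral_mono_on_of_le_Ioo (by positivity) ?_
    (hTi.continuousOn_mul hcont.continuousOn) ?_
  · have := (hPi.comp_mul_left (c := t)).const_mul t
    simpa using this
  · rintro x ⟨hx, -⟩
    have hpow : ∀ r : ℝ, t ^ r * (t * x) ^ (-r) = x ^ (-r) := fun r => by
      rw [Real.mul_rpow ht.le hx.le, ← mul_assoc, ← Real.rpow_add ht, add_neg_cancel,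
        Real.rpow_zero, one_mul]
    have hPx : P (t * x) = c' * x ^ (-ν) * Real.cos (t * x) - (ε * x ^ (-ν) + C * x ^ (-ρ)) := by
      rw [hP, ← hpow ν, ← hpow ρ]
      ring
    rw [hPx, mul_assoc t]
    refine mul_le_mul_of_nonneg_left ?_ ht.le
    have h1 : |Real.cos (t * x) * (T x - c' * x ^ (-ν))| ≤ ε * x ^ (-ν) + C * x ^ (-ρ) := by
      rw [abs_mul]
      exact (mul_le_of_le_one_left (abs_nonneg _) (Real.abs_cos_le_one _)).trans (hT x hx)
    linarith [(abs_le.1 h1).1]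

theorem sum_mul_sin_sub_le_tsum {f : ℕ → ℝ} (hf : ∀ k, 0 ≤ f k) (hsum : Summable f) (t : ℝ)
    (s : Finset ℕ) :
    ∑ k ∈ s, f k * Real.sin (t * k) - (∑' k, f k - ∑ k ∈ s, f k) ≤
      ∑' k : ℕ, f k * Real.sin (t * k) := by
  have hsin : Summable fun k : ℕ => f k * Real.sin (t * k) :=
    hsum.of_norm_bounded fun k => by
      rw [norm_mul, Real.norm_of_nonneg (hf k)]
      exact mul_le_of_le_one_right (hf k) (Real.abs_sin_le_one _)
  have h := (hsum.add hsin).sum_le_tsum s fun k _ => by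
    nlinarith [hf k, Real.neg_one_le_sin (t * k)]
  rw [hsum.tsum_add hsin, Finset.sum_add_distrib] at h
  linarith

/-- Let `f : ℕ → [0,∞)` with tail sums `S(k) = Σ_{y ≥ k} f(y)` satisfying
`S(k) = c' k^{-ν} + o(k^{-ν})` as `k → ∞` for some `c' > 0` and `ν ∈ (0,1)`.
Then there exists `t₀ > 0` such that `Σ_{k ≥ 0} f(k) sin(tk) > 0` for all
`t ∈ (0, t₀]`. -/
theorem stmt_17
    (f : ℕ → ℝ) (hf : ∀ k, 0 ≤ f k)
    (S : ℕ → ℝ) (hS : ∀ k, S k = ∑' y : ℕ, if k ≤ y then f y else 0)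
    (c' : ℝ) (hc' : 0 < c')
    (ν : ℝ) (hν0 : 0 < ν) (hν1 : ν < 1)
    (hasymp : (fun k : ℕ => S k - c' * (k : ℝ) ^ (-ν))
      =o[atTop] fun k : ℕ => (k : ℝ) ^ (-ν)) :
    ∃ t₀ : ℝ, 0 < t₀ ∧ ∀ t : ℝ, 0 < t → t ≤ t₀ →
      0 < ∑' k : ℕ, f k * Real.sin (t * (k : ℝ)) := by
  have hsum := summable_of_tail_asymp hS hc' hasymp
  set T : ℝ → ℝ := fun x => S (⌊x⌋₊ + 1) with hTdef
  have hT : ∀ x : ℝ, T x = ∑' k, f k - ∑ k ∈ Finset.Icc 0 ⌊x⌋₊, f k := fun x =>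
    tail_eq_tsum_sub hS hsum _
  have hTanti : Antitone T := fun x y hxy => by
    rw [hT, hT]
    exact sub_le_sub_left (Finset.sum_le_sum_of_subset_of_nonneg
      (Finset.Icc_subset_Icc_right (Nat.floor_mono hxy)) fun k _ _ => hf k) _
  have hTbound : ∀ x, |T x| ≤ ∑' k, f k := fun x => by
    rw [hT, abs_of_nonneg (sub_nonneg.2 (hsum.sum_le_tsum _ fun k _ => hf k))]
    exact sub_le_self _ (Finset.sum_nonneg fun k _ => hf k)
  obtain ⟨ρ, hνρ, hρ1⟩ := exists_between hν1
  set κ := ∫ u in (0 : ℝ)..(2 * Real.pi), u ^ (-ν) * Real.cos u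
  have hκ : 0 < κ := integral_rpow_neg_mul_cos_two_pi_pos hν0 hν1
  obtain ⟨m, hm⟩ : ∃ m : ℕ, (((m + 1 : ℕ) : ℝ) * (2 * Real.pi)) ^ (-ν) < κ / 4 := by
    have h : Tendsto (fun m : ℕ => (((m + 1 : ℕ) : ℝ) * (2 * Real.pi)) ^ (-ν)) atTop (nhds 0) :=
      (tendsto_rpow_neg_atTop hν0).comp (((tendsto_natCast_atTop_atTop (R := ℝ)).comp
        (tendsto_add_atTop_nat 1)).atTop_mul_const Real.two_pi_pos)
    exact (h.eventually_lt_const (by positivity)).exists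
  have hJ := integral_rpow_neg_mul_cos_two_pi_le hν0 hν1 m
  have hsinR : Real.sin (((m + 1 : ℕ) : ℝ) * (2 * Real.pi)) = 0 := by
    simpa only [zero_add, Real.sin_zero] using Real.sin_add_nat_mul_two_pi 0 (m + 1)
  have hR : 0 < ((m + 1 : ℕ) : ℝ) * (2 * Real.pi) := by positivity
  set R := ((m + 1 : ℕ) : ℝ) * (2 * Real.pi)
  have hI : ∀ r : ℝ, 0 ≤ ∫ u in 0..R, u ^ (-r) := fun r =>
    intervalIntegral.integral_nonneg hR.le fun u hu => Real.rpow_nonneg hu.1 _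
  set D := (∫ u in 0..R, u ^ (-ν)) + R ^ (-ν) with hD
  have hDpos : 0 < D := add_pos_of_nonneg_of_pos (hI ν) (Real.rpow_pos_of_pos hR _)
  obtain ⟨C, hC, hE⟩ := exists_abs_sub_le_rpow_add_rpow hTbound hc' hν0 hνρ
    (tendsto_tail_floor_mul_rpow hasymp) (ε := c' * κ / 4 / D) (by positivity)
  set ε := c' * κ / 4 / D
  have hεD : ε * D = c' * κ / 4 := div_mul_cancel₀ _ hDpos.ne'
  have hsmall : ∀ᶠ t : ℝ in nhds 0,
      t ^ (ρ - ν) * (C * ((∫ u in 0..R, u ^ (-ρ)) + R ^ (-ρ))) < c' * κ / 4 := by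
    have h := ((Real.continuousAt_rpow_const 0 (ρ - ν) (Or.inr (by linarith))).tendsto).mul_const
      (C * ((∫ u in 0..R, u ^ (-ρ)) + R ^ (-ρ)))
    rw [Real.zero_rpow (by linarith), zero_mul] at h
    exact h.eventually_lt_const (by positivity)
  obtain ⟨δ, hδ, hδt⟩ := Metric.eventually_nhds_iff.1 hsmall
  refine ⟨δ / 2, half_pos hδ, fun t ht htδ => ?_⟩
  have hts := hδt (y := t) (by rw [Real.dist_eq, sub_zero, abs_of_pos ht]; linarith)
  have hb : 0 < R / t := by positivity
  have hTi : IntervalIntegrable T MeasureTheory.volume 0 (R / t) :=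
    (hTanti.antitoneOn _).intervalIntegrable
  have h1 := sum_mul_sin_sub_le_tsum hf hsum t (Finset.Icc 0 ⌊R / t⌋₊)
  rw [← hT, sum_mul_sin_eq_integral hT hb.le hTi (by rwa [mul_div_cancel₀ _ ht.ne'])] at h1
  have h2 := le_integral_mul_cos_mul hν1 hρ1 ht hR hTi hE
  have hpow : ∀ r : ℝ, (R / t) ^ (-r) = t ^ r * R ^ (-r) := fun r => by
    rw [Real.div_rpow hR.le ht.le, Real.rpow_neg ht.le, div_inv_eq_mul, mul_comm]
  have h3 := (abs_le.1 (hE (R / t) hb)).2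
  rw [hpow, hpow] at h3
  have htρ : t ^ ρ = t ^ ν * t ^ (ρ - ν) := by
    rw [← Real.rpow_add ht, add_sub_cancel]
  rw [htρ] at h2 h3
  have htν := Real.rpow_pos_of_pos ht ν
  have hmain : 0 < t ^ ν * (c' * (∫ u in 0..R, u ^ (-ν) * Real.cos u) - c' * R ^ (-ν) - ε * D
      - t ^ (ρ - ν) * (C * ((∫ u in 0..R, u ^ (-ρ)) + R ^ (-ρ)))) := by
    refine mul_pos htν ?_
    rw [hεD]
    nlinarith [mul_le_mul_of_nonneg_left hJ hc'.le, mul_lt_mul_of_pos_left hm hc']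
  rw [hD] at hmain
  linarith
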